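/- (Transversality condition at the terminal time; specialization of Theorem 5 to the time scale T = ℝ, where σ(ρ(b)) = b holds automatically.) Let x̂ be a weak local extremizer of L with the value x(b) not specified (and x(a) = x_a possibly specified). Then, in addition to the Euler–Lagrange equation, Σ_{i=1}^{m} H_i'(F_1(x̂),…,F_m(x̂)) · f_{iv}(b, x̂(b), x̂'(b)) = 0, where F_i(x̂) = ∫_a^b f_i(t, x̂(t), x̂'(t)) dt. -/

import Mathlib

open Set intervalIntegral

/-- Sup norm of `g` over the interval `[a, b]`. -/
noncomputable def supIcc (a b : ℝ) (g : ℝ → ℝ) : ℝ :=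
  ⨆ t : Icc a b, |g t.1|

open scoped Topology Interval

/-- A function on `Fin n → ℝ` with continuous partial derivatives is differentiable. -/
theorem hasFDerivAt_of_continuous_partial_derivs {n : ℕ} {H : (Fin n → ℝ) → ℝ}
    {H' : Fin n → (Fin n → ℝ) → ℝ}
    (hH : ∀ i z, HasDerivAt (fun s => H (Function.update z i s)) (H' i z) (z i))
    (hH' : ∀ i, Continuous (H' i)) (z : Fin n → ℝ) :
    HasFDerivAt H (∑ i, H' i z • (ContinuousLinearMap.proj i : (Fin n → ℝ) →L[ℝ] ℝ)) z := by
  induction n with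
  | zero =>
    simpa using hasFDerivAt_of_subsingleton H z
  | succ n ih =>
    have hcons : Continuous fun p : ℝ × (Fin n → ℝ) => (Fin.cons p.1 p.2 : Fin (n + 1) → ℝ) :=
      continuous_pi fun i => by
        refine Fin.cases ?_ (fun j => ?_) i
        · simpa using continuous_fst
        · exact (continuous_apply j).comp continuous_snd
    have key := hasStrictFDerivAt_uncurry_coprod (𝕜 := ℝ) (u := (z 0, Fin.tail z))
      (f := fun y w => H (Fin.cons y w))
      (f₁ := fun y w => ContinuousLinearMap.toSpanSingleton ℝ (H' 0 (Fin.cons y w)))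
      (f₂ := fun y w => ∑ i : Fin n, H' i.succ (Fin.cons y w) •
        (ContinuousLinearMap.proj i : (Fin n → ℝ) →L[ℝ] ℝ))
      (.of_forall fun p => by
        have h := hH 0 (Fin.cons p.1 p.2)
        simp only [Fin.update_cons_zero, Fin.cons_zero] at h
        exact h.hasFDerivAt)
      (.of_forall fun p => by
        refine ih (H := fun w => H (Fin.cons p.1 w))
          (H' := fun i w => H' i.succ (Fin.cons p.1 w)) (fun i w => ?_) (fun i => ?_) p.2
        · have h := hH i.succ (Fin.cons p.1 w)
          simpa only [← Fin.cons_update, Fin.cons_succ] using h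
        · exact (hH' i.succ).comp (hcons.comp (Continuous.prodMk_right p.1)))
      (by
        have h : Continuous fun p : ℝ × (Fin n → ℝ) =>
            ContinuousLinearMap.toSpanSingleton ℝ (H' 0 (Fin.cons p.1 p.2)) :=
          (ContinuousLinearMap.toSpanSingletonCLE (𝕜 := ℝ) (E := ℝ)).continuous.comp
            ((hH' 0).comp hcons)
        exact h.continuousAt)
      (by
        have h : Continuous fun p : ℝ × (Fin n → ℝ) => ∑ i : Fin n,
            H' i.succ (Fin.cons p.1 p.2) •
              (ContinuousLinearMap.proj i : (Fin n → ℝ) →L[ℝ] ℝ) :=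
          continuous_finsetSum _ fun i _ =>
            ((hH' i.succ).comp hcons).smul continuous_const
        exact h.continuousAt)
    have hsplit : HasFDerivAt (fun w : Fin (n + 1) → ℝ => (w 0, Fin.tail w))
        ((ContinuousLinearMap.proj 0 : (Fin (n + 1) → ℝ) →L[ℝ] ℝ).prod
          (ContinuousLinearMap.pi fun i : Fin n => ContinuousLinearMap.proj i.succ)) z :=
      ContinuousLinearMap.hasFDerivAt
        ((ContinuousLinearMap.proj 0 : (Fin (n + 1) → ℝ) →L[ℝ] ℝ).prod
          (ContinuousLinearMap.pi fun i : Fin n => ContinuousLinearMap.proj i.succ))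
    have h := key.hasFDerivAt.comp z hsplit
    convert! h using 1
    · ext w
      simp [Function.HasUncurry.uncurry]
    · ext w
      simp [Function.HasUncurry.uncurry, Fin.sum_univ_succ, mul_comm]

/-- Derivative along a line of a bivariate function with continuous partial derivatives. -/
theorem hasDerivAt_comp_line {g gy gv : ℝ → ℝ → ℝ}
    (hy : ∀ y v, HasDerivAt (fun y' => g y' v) (gy y v) y)
    (hv : ∀ y v, HasDerivAt (fun v' => g y v') (gv y v) v)
    (hyc : Continuous fun p : ℝ × ℝ => gy p.1 p.2)
    (hvc : Continuous fun p : ℝ × ℝ => gv p.1 p.2) (y v p q s : ℝ) :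
    HasDerivAt (fun s => g (y + s * p) (v + s * q))
      (gy (y + s * p) (v + s * q) * p + gv (y + s * p) (v + s * q) * q) s := by
  have key := hasStrictFDerivAt_uncurry_coprod (𝕜 := ℝ) (u := (y + s * p, v + s * q)) (f := g)
    (f₁ := fun y v => ContinuousLinearMap.toSpanSingleton ℝ (gy y v))
    (f₂ := fun y v => ContinuousLinearMap.toSpanSingleton ℝ (gv y v))
    (.of_forall fun w => (hy w.1 w.2).hasFDerivAt) (.of_forall fun w => (hv w.1 w.2).hasFDerivAt)
    ((ContinuousLinearMap.toSpanSingletonCLE (𝕜 := ℝ) (E := ℝ)).continuous.comp hyc).continuousAt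
    ((ContinuousLinearMap.toSpanSingletonCLE (𝕜 := ℝ) (E := ℝ)).continuous.comp hvc).continuousAt
  have hline : ∀ c d : ℝ, HasDerivAt (fun s => c + s * d) d s := fun c d => by
    simpa using ((hasDerivAt_id s).mul_const d).const_add c
  have h := key.hasFDerivAt.comp_hasDerivAt s ((hline y p).prodMk (hline v q))
  convert! h using 1
  simp [Function.HasUncurry.uncurry, mul_comm]

/-- First variation of the integral functional `∫ f(t, x, x')` in the direction `η`. -/
theorem hasDerivAt_integral_variation {a b : ℝ} (hab : a ≤ b) {f fy fv : ℝ → ℝ → ℝ → ℝ}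
    (hf : ContinuousOn (fun p : ℝ × ℝ × ℝ => f p.1 p.2.1 p.2.2) (Icc a b ×ˢ univ))
    (hfy : ∀ t ∈ Icc a b, ∀ y v : ℝ, HasDerivAt (fun y' => f t y' v) (fy t y v) y)
    (hfv : ∀ t ∈ Icc a b, ∀ y v : ℝ, HasDerivAt (fun v' => f t y v') (fv t y v) v)
    (hfyc : ContinuousOn (fun p : ℝ × ℝ × ℝ => fy p.1 p.2.1 p.2.2) (Icc a b ×ˢ univ))
    (hfvc : ContinuousOn (fun p : ℝ × ℝ × ℝ => fv p.1 p.2.1 p.2.2) (Icc a b ×ˢ univ))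
    {x x' η η' : ℝ → ℝ} (hx : ContinuousOn x (Icc a b)) (hx' : ContinuousOn x' (Icc a b))
    (hη : ContinuousOn η (Icc a b)) (hη' : ContinuousOn η' (Icc a b)) :
    HasDerivAt (fun s => ∫ t in a..b, f t (x t + s * η t) (x' t + s * η' t))
      (∫ t in a..b, (fy t (x t) (x' t) * η t + fv t (x t) (x' t) * η' t)) 0 := by
  have hcomp : ∀ {g : ℝ → ℝ → ℝ → ℝ},
      ContinuousOn (fun p : ℝ × ℝ × ℝ => g p.1 p.2.1 p.2.2) (Icc a b ×ˢ univ) →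
      ContinuousOn (fun p : ℝ × ℝ => g p.2 (x p.2 + p.1 * η p.2) (x' p.2 + p.1 * η' p.2))
        (univ ×ˢ Icc a b) := fun {g} hg => by
    have hsnd : ∀ {u : ℝ → ℝ}, ContinuousOn u (Icc a b) →
        ContinuousOn (fun p : ℝ × ℝ => u p.2) (univ ×ˢ Icc a b) := fun hu =>
      hu.comp continuousOn_snd fun p hp => hp.2
    refine hg.comp (f := fun p : ℝ × ℝ =>
      (p.2, x p.2 + p.1 * η p.2, x' p.2 + p.1 * η' p.2)) ?_ fun p hp => ⟨hp.2, trivial⟩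
    exact continuousOn_snd.prodMk
      (((hsnd hx).add (continuousOn_fst.mul (hsnd hη))).prodMk
        ((hsnd hx').add (continuousOn_fst.mul (hsnd hη'))))
  have hslice : ∀ {g : ℝ → ℝ → ℝ}, ContinuousOn (fun p : ℝ × ℝ => g p.1 p.2) (univ ×ˢ Icc a b) →
      ∀ s, ContinuousOn (g s) (Icc a b) := fun hg s =>
    hg.comp (f := fun t => (s, t)) (by fun_prop) fun t ht => ⟨trivial, ht⟩
  have hF : ∀ s, ContinuousOn (fun t => f t (x t + s * η t) (x' t + s * η' t)) (Icc a b) :=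
    hslice (g := fun s t => f t (x t + s * η t) (x' t + s * η' t)) (hcomp hf)
  have hsubset : Ι a b ⊆ Icc a b := by
    rw [uIoc_of_le hab]; exact Ioc_subset_Icc_self
  set D : ℝ → ℝ → ℝ := fun s t =>
    fy t (x t + s * η t) (x' t + s * η' t) * η t + fv t (x t + s * η t) (x' t + s * η' t) * η' t
  have hD : ContinuousOn (fun p : ℝ × ℝ => D p.1 p.2) (univ ×ˢ Icc a b) :=
    ((hcomp hfyc).mul (hη.comp continuousOn_snd fun p hp => hp.2)).add
      ((hcomp hfvc).mul (hη'.comp continuousOn_snd fun p hp => hp.2))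
  obtain ⟨C, hC⟩ := (isCompact_Icc (a := (-1 : ℝ)) (b := 1)).prod (isCompact_Icc (a := a) (b := b))
    |>.exists_bound_of_continuousOn (hD.mono (prod_mono (subset_univ _) subset_rfl))
  have h := (hasDerivAt_integral_of_dominated_loc_of_deriv_le (μ := MeasureTheory.volume) (a := a) (b := b)
    (F := fun s t => f t (x t + s * η t) (x' t + s * η' t)) (F' := D) (x₀ := 0)
    (s := Icc (-1) 1) (bound := fun _ => C) (Icc_mem_nhds (by norm_num) (by norm_num))
    (.of_forall fun s => ((hF s).mono hsubset).aestronglyMeasurable measurableSet_uIoc)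
    ((hF 0).intervalIntegrable_of_Icc hab)
    (((hslice hD 0).mono hsubset).aestronglyMeasurable measurableSet_uIoc)
    (.of_forall fun t ht s hs => hC (s, t) ⟨hs, hsubset ht⟩)
    intervalIntegrable_const
    (.of_forall fun t ht s _ => hasDerivAt_comp_line (hfy t (hsubset ht)) (hfv t (hsubset ht))
      (hfyc.comp_continuous (f := fun p : ℝ × ℝ => (t, p)) (by fun_prop)
        fun p => ⟨hsubset ht, trivial⟩)
      (hfvc.comp_continuous (f := fun p : ℝ × ℝ => (t, p)) (by fun_prop)
        fun p => ⟨hsubset ht, trivial⟩) _ _ _ _ _)).2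
  simpa [D] using h

/-- Du Bois-Reymond lemma with a free right endpoint. -/
theorem eq_integral_sub_integral_of_forall_integral_eq_zero {a b : ℝ} (hab : a < b)
    {G P : ℝ → ℝ} (hG : ContinuousOn G (Icc a b)) (hP : ContinuousOn P (Icc a b))
    (h : ∀ g : ℝ → ℝ, Continuous g →
      ∫ t in a..b, (G t * (∫ s in a..t, g s) + P t * g t) = 0) {t : ℝ} (ht : t ∈ Icc a b) :
    P t = (∫ s in a..t, G s) - ∫ s in a..b, G s := by
  set G₁ : ℝ → ℝ := IccExtend hab.le ((Icc a b).domRestrict G)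
  set P₁ : ℝ → ℝ := IccExtend hab.le ((Icc a b).domRestrict P)
  have hG₁ : Continuous G₁ := hG.domRestrict.Icc_extend'
  have hP₁ : Continuous P₁ := hP.domRestrict.Icc_extend'
  have eG : ∀ s ∈ Icc a b, G₁ s = G s := fun s hs => by simp [G₁, IccExtend_of_mem hab.le _ hs]
  have eP : ∀ s ∈ Icc a b, P₁ s = P s := fun s hs => by simp [P₁, IccExtend_of_mem hab.le _ hs]
  have hprim : ∀ {u : ℝ → ℝ}, Continuous u → ∀ r, HasDerivAt (fun r => ∫ s in a..r, u s) (u r) r :=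
    fun hu r => hu.integral_hasStrictDerivAt a r |>.hasDerivAt
  have hprimc : ∀ {u : ℝ → ℝ}, Continuous u → Continuous fun r => ∫ s in a..r, u s :=
    fun hu => continuous_iff_continuousAt.2 fun r => (hprim hu r).continuousAt
  have eA : ∀ r ∈ Icc a b, ∫ s in a..r, G₁ s = ∫ s in a..r, G s := fun r hr =>
    integral_congr fun s hs => by
      rw [uIcc_of_le hr.1] at hs
      exact eG s ⟨hs.1, hs.2.trans hr.2⟩
  set A : ℝ → ℝ := fun r => ∫ s in a..r, G₁ s
  have hA : Continuous A := hprimc hG₁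
  set g : ℝ → ℝ := fun r => P₁ r - A r + A b
  have hg : Continuous g := by fun_prop
  have hgi := hprimc hg
  have hparts : ∫ r in a..b, (G₁ r * (∫ s in a..r, g s) + A r * g r) = A b * ∫ s in a..b, g s := by
    rw [integral_eq_sub_of_hasDerivAt (f := fun r => A r * ∫ s in a..r, g s)
      (fun r _ => (hprim hG₁ r).mul (hprim hg r))
      (Continuous.intervalIntegrable (by fun_prop) _ _)]
    simp
  have hzero : ∫ r in a..b, (G₁ r * (∫ s in a..r, g s) + P₁ r * g r) = 0 := by
    rw [← h g hg]
    refine integral_congr fun r hr => ?_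
    rw [uIcc_of_le hab.le] at hr
    simp only [eG r hr, eP r hr]
  have hsq : ∫ r in a..b, g r * g r = 0 := by
    have : (fun r => g r * g r) = fun r => (G₁ r * (∫ s in a..r, g s) + P₁ r * g r) -
        (G₁ r * (∫ s in a..r, g s) + A r * g r) + A b * g r := by
      funext r
      simp only [g]
      ring
    rw [this, integral_add (Continuous.intervalIntegrable (by fun_prop) _ _)
      (Continuous.intervalIntegrable (by fun_prop) _ _),
      integral_sub (Continuous.intervalIntegrable (by fun_prop) _ _)
      (Continuous.intervalIntegrable (by fun_prop) _ _), hzero, hparts, integral_const_mul]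
    ring
  have hgt : g t = 0 := by
    by_contra hne
    exact (integral_pos hab (hg.mul hg).continuousOn (fun r _ => mul_self_nonneg _)
      ⟨t, ht, mul_self_pos.2 hne⟩).ne' hsq
  have e₁ := eA t ht
  have e₂ := eA b (right_mem_Icc.2 hab.le)
  have e₃ := eP t ht
  simp only [g, A] at hgt
  linarith

/-- `supIcc` of a scaled function is at most the scaling factor times a bound. -/
theorem supIcc_mul_le {a b M : ℝ} (hab : a ≤ b) {g : ℝ → ℝ} (hM : ∀ t ∈ Icc a b, ‖g t‖ ≤ M)
    (s : ℝ) : supIcc a b (fun t => s * g t) ≤ |s| * M := by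
  have : Nonempty (Icc a b) := ⟨⟨a, left_mem_Icc.2 hab⟩⟩
  refine ciSup_le fun t => ?_
  rw [abs_mul]
  exact mul_le_mul_of_nonneg_left (hM t t.2) (abs_nonneg s)

/-- Transversality condition at the terminal time `t = b`
(specialization of Theorem 5 to the time scale `T = ℝ`):
if `xh` is a weak local extremizer with `x(b)` not specified
(and `x(a) = xa` specified), then the Euler–Lagrange equation holds together with
`∑ i, H'_i · f_{iv}(b, xh(b), xh'(b)) = 0`. -/
theorem transversality_terminal_time
    (a b : ℝ) (hab : a < b) (m : ℕ) (hm : 1 ≤ m) (xa : ℝ)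
    (f fy fv : Fin m → ℝ → ℝ → ℝ → ℝ)
    (H : (Fin m → ℝ) → ℝ) (H' : Fin m → (Fin m → ℝ) → ℝ)
    (hf : ∀ i, ContinuousOn (fun p : ℝ × ℝ × ℝ => f i p.1 p.2.1 p.2.2)
      (Icc a b ×ˢ (univ : Set (ℝ × ℝ))))
    (hfy : ∀ i, ∀ t ∈ Icc a b, ∀ y v : ℝ,
      HasDerivAt (fun y' => f i t y' v) (fy i t y v) y)
    (hfv : ∀ i, ∀ t ∈ Icc a b, ∀ y v : ℝ,
      HasDerivAt (fun v' => f i t y v') (fv i t y v) v)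
    (hfyc : ∀ i, ContinuousOn (fun p : ℝ × ℝ × ℝ => fy i p.1 p.2.1 p.2.2)
      (Icc a b ×ˢ (univ : Set (ℝ × ℝ))))
    (hfvc : ∀ i, ContinuousOn (fun p : ℝ × ℝ × ℝ => fv i p.1 p.2.1 p.2.2)
      (Icc a b ×ˢ (univ : Set (ℝ × ℝ))))
    (hH : ∀ i z, HasDerivAt (fun s => H (Function.update z i s)) (H' i z) (z i))
    (hH' : ∀ i, Continuous (H' i))
    (xh xh' : ℝ → ℝ)
    (hxh : ∀ t ∈ Icc a b, HasDerivAt xh (xh' t) t)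
    (hxhc : ContinuousOn xh' (Icc a b))
    (hxa : xh a = xa)
    (hext : ∃ δ > (0:ℝ),
      (∀ x x' : ℝ → ℝ,
        (∀ t ∈ Icc a b, HasDerivAt x (x' t) t) → ContinuousOn x' (Icc a b) →
        x a = xa →
        supIcc a b (fun t => x t - xh t) + supIcc a b (fun t => x' t - xh' t) < δ →
        H (fun i => ∫ t in a..b, f i t (xh t) (xh' t))
          ≤ H (fun i => ∫ t in a..b, f i t (x t) (x' t))) ∨
      (∀ x x' : ℝ → ℝ,
        (∀ t ∈ Icc a b, HasDerivAt x (x' t) t) → ContinuousOn x' (Icc a b) →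
        x a = xa →
        supIcc a b (fun t => x t - xh t) + supIcc a b (fun t => x' t - xh' t) < δ →
        H (fun i => ∫ t in a..b, f i t (x t) (x' t))
          ≤ H (fun i => ∫ t in a..b, f i t (xh t) (xh' t)))) :
    (∃ c : ℝ, ∀ t ∈ Icc a b,
      ∑ i : Fin m, H' i (fun j => ∫ s in a..b, f j s (xh s) (xh' s)) *
        (fv i t (xh t) (xh' t) - ∫ τ in a..t, fy i τ (xh τ) (xh' τ)) = c) ∧
    ∑ i : Fin m, H' i (fun j => ∫ s in a..b, f j s (xh s) (xh' s)) *
      fv i b (xh b) (xh' b) = 0 := by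
  set z₀ : Fin m → ℝ := fun j => ∫ s in a..b, f j s (xh s) (xh' s) with hz₀
  have hxc : ContinuousOn xh (Icc a b) := fun t ht => (hxh t ht).continuousAt.continuousWithinAt
  have hlift : ContinuousOn (fun t => (t, xh t, xh' t)) (Icc a b) :=
    continuousOn_id.prodMk (hxc.prodMk hxhc)
  have hmaps : MapsTo (fun t => (t, xh t, xh' t)) (Icc a b) (Icc a b ×ˢ (univ : Set (ℝ × ℝ))) :=
    fun t ht => ⟨ht, trivial⟩
  have hfy₀ : ∀ i, ContinuousOn (fun t => fy i t (xh t) (xh' t)) (Icc a b) := fun i =>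
    (hfyc i).comp hlift hmaps
  have hfv₀ : ∀ i, ContinuousOn (fun t => fv i t (xh t) (xh' t)) (Icc a b) := fun i =>
    (hfvc i).comp hlift hmaps
  have hG : ∀ i, ContinuousOn (fun t => H' i z₀ * fy i t (xh t) (xh' t)) (Icc a b) := fun i =>
    continuousOn_const.mul (hfy₀ i)
  have hP : ∀ i, ContinuousOn (fun t => H' i z₀ * fv i t (xh t) (xh' t)) (Icc a b) := fun i =>
    continuousOn_const.mul (hfv₀ i)
  have hvar : ∀ g : ℝ → ℝ, Continuous g →
      ∫ t in a..b, ((∑ i, H' i z₀ * fy i t (xh t) (xh' t)) * (∫ s in a..t, g s) +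
        (∑ i, H' i z₀ * fv i t (xh t) (xh' t)) * g t) = 0 := by
    intro g hg
    set η : ℝ → ℝ := fun t => ∫ s in a..t, g s
    have hη : ∀ t, HasDerivAt η (g t) t := fun t => (hg.integral_hasStrictDerivAt a t).hasDerivAt
    have hηc : Continuous η := continuous_iff_continuousAt.2 fun t => (hη t).continuousAt
    have hd := fun i => hasDerivAt_integral_variation hab.le (hf i) (hfy i) (hfv i) (hfyc i)
      (hfvc i) hxc hxhc hηc.continuousOn hg.continuousOn
    set φ : ℝ → Fin m → ℝ := fun s i => ∫ t in a..b, f i t (xh t + s * η t) (xh' t + s * g t)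
    have hφ₀ : φ 0 = z₀ := by simp [φ, hz₀]
    have hL := (hasFDerivAt_of_continuous_partial_derivs hH hH' (φ 0)).comp_hasDerivAt 0
      (hasDerivAt_pi.2 hd)
    obtain ⟨δ, hδ, hext⟩ := hext
    obtain ⟨M₁, hM₁⟩ := isCompact_Icc.exists_bound_of_continuousOn
      (hηc.continuousOn (s := Icc a b))
    obtain ⟨M₂, hM₂⟩ := isCompact_Icc.exists_bound_of_continuousOn
      (hg.continuousOn (s := Icc a b))
    have hsmall : ∀ᶠ s in 𝓝 (0 : ℝ), |s| * M₁ + |s| * M₂ < δ := by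
      refine ContinuousAt.eventually_lt (f := fun s : ℝ => |s| * M₁ + |s| * M₂)
        (Continuous.continuousAt (by fun_prop)) continuousAt_const ?_
      simpa using hδ
    have hnear : ∀ᶠ s in 𝓝 (0 : ℝ), supIcc a b (fun t => xh t + s * η t - xh t) +
        supIcc a b (fun t => xh' t + s * g t - xh' t) < δ := by
      filter_upwards [hsmall] with s hs
      simp only [add_sub_cancel_left]
      exact (add_le_add (supIcc_mul_le hab.le hM₁ s) (supIcc_mul_le hab.le hM₂ s)).trans_lt hs
    have hadm₁ : ∀ s, ∀ t ∈ Icc a b,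
        HasDerivAt (fun t => xh t + s * η t) (xh' t + s * g t) t := fun s t ht =>
      (hxh t ht).add ((hη t).const_mul s)
    have hadm₂ : ∀ s, ContinuousOn (fun t => xh' t + s * g t) (Icc a b) := fun s =>
      hxhc.add (continuous_const.mul hg).continuousOn
    have hadm₃ : ∀ s, xh a + s * η a = xa := fun s => by simp [η, hxa]
    have hextr : IsLocalExtr (H ∘ φ) 0 := by
      refine hext.imp (fun h => ?_) fun h => ?_
      · filter_upwards [hnear] with s hs
        simpa only [Function.comp_apply, hφ₀] using h _ _ (hadm₁ s) (hadm₂ s) (hadm₃ s) hs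
      · filter_upwards [hnear] with s hs
        simpa only [Function.comp_apply, hφ₀] using h _ _ (hadm₁ s) (hadm₂ s) (hadm₃ s) hs
    have hzero := hextr.hasDerivAt_eq_zero hL
    rw [hφ₀] at hzero
    simp only [sum_apply, smul_apply,
      ContinuousLinearMap.proj_apply, smul_eq_mul, ← integral_const_mul] at hzero
    have hint : ∀ i, IntervalIntegrable (fun t => H' i z₀ *
        (fy i t (xh t) (xh' t) * η t + fv i t (xh t) (xh' t) * g t)) MeasureTheory.volume a b :=
      fun i => ContinuousOn.intervalIntegrable_of_Icc hab.le
        (continuousOn_const.mul (((hfy₀ i).mul hηc.continuousOn).add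
          ((hfv₀ i).mul hg.continuousOn)))
    rw [← integral_finsetSum fun i _ => hint i] at hzero
    rw [← hzero]
    congr 1 with t
    rw [Finset.sum_mul, Finset.sum_mul, ← Finset.sum_add_distrib]
    exact Finset.sum_congr rfl fun i _ => by ring
  have hEL : ∀ t ∈ Icc a b, _ := fun t ht =>
    eq_integral_sub_integral_of_forall_integral_eq_zero hab
      (continuousOn_finsetSum _ fun i _ => hG i) (continuousOn_finsetSum _ fun i _ => hP i)
      hvar ht
  refine ⟨⟨-∫ s in a..b, ∑ i, H' i z₀ * fy i s (xh s) (xh' s), fun t ht => ?_⟩, ?_⟩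
  · have hint : ∫ s in a..t, ∑ i, H' i z₀ * fy i s (xh s) (xh' s) =
        ∑ i, H' i z₀ * ∫ s in a..t, fy i s (xh s) (xh' s) := by
      rw [integral_finsetSum fun i _ => ContinuousOn.intervalIntegrable_of_Icc ht.1
        ((hG i).mono (Icc_subset_Icc_right ht.2))]
      simp only [integral_const_mul]
    simp only [mul_sub, Finset.sum_sub_distrib]
    rw [hEL t ht, ← hint]
    ring
  · simpa using hEL b (right_mem_Icc.2 hab.le)
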